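/- Let p, q ≥ 0 with n = p + q ≥ 2, let η = diag(1, …, 1, −1, …, −1) be the flat metric of signature (p, q) on ℝ^n, and let a, b, c ∈ ℝ. Suppose that for every smooth symmetric contravariant 2-tensor field g^{ij} on ℝ^n the operator Q_{a,b,c}(g) f = g^{ij} ∂_i ∂_j f + a (∂_j g^{ij}) ∂_i f + b (∂_i ∂_j g^{ij}) f + c η^{kl} ∂_k ∂_l (η_{ij} g^{ij}) f satisfies Q_{a,b,c}(L_X g) = ℓ_X ∘ Q_{a,b,c}(g) − Q_{a,b,c}(g) ∘ ℓ_X for every X in the linear span of the conformal generators ∂_i, x_i ∂_j − x_j ∂_i, E = x^j ∂_j, x_j x^j ∂_i − 2 x_i E (with x_i = η_{ij} x^j), where (L_X g)^{ij} = X^k ∂_k g^{ij} − g^{kj} ∂_k X^i − g^{ik} ∂_k X^j and ℓ_X f = X^i ∂_i f + (1/2)(∂_i X^i) f. Then a = 1, b = n/(4(n+1)), and c = n/(4(n+1)(n+2)). -/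

import Mathlib

set_option maxHeartbeats 1000000

/-- The `i`-th partial derivative of a function on `ℝⁿ`. -/
noncomputable def pd {n : ℕ} (i : Fin n) (f : (Fin n → ℝ) → ℝ) : (Fin n → ℝ) → ℝ :=
  fun x => fderiv ℝ f x (Pi.single i 1)

/-- The flat metric `η = diag(1, …, 1, −1, …, −1)` of signature `(p, q)` (diagonal
entries; indices are raised and lowered with the same signs). -/
def etaSgn (p q : ℕ) : Fin (p + q) → ℝ := fun i => if (i : ℕ) < p then 1 else -1

/-- The conformal generators on ℝⁿ, `n = p + q`, viewed as vector fields: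
translations `∂ᵢ`, rotations `xᵢ∂ⱼ − xⱼ∂ᵢ`, the Euler field `E = xʲ∂ⱼ`, and the
inversions `xⱼxʲ∂ᵢ − 2xᵢE`, where `xᵢ = ηᵢⱼxʲ`. -/
def confGenSm (p q : ℕ) : Set (Fin (p + q) → (Fin (p + q) → ℝ) → ℝ) :=
  (Set.range fun i : Fin (p + q) =>
    fun m (_ : Fin (p + q) → ℝ) => if m = i then (1 : ℝ) else 0) ∪
  (Set.range fun pr : Fin (p + q) × Fin (p + q) =>
    fun m (x : Fin (p + q) → ℝ) =>
      (if m = pr.2 then etaSgn p q pr.1 * x pr.1 else 0)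
        - (if m = pr.1 then etaSgn p q pr.2 * x pr.2 else 0)) ∪
  {fun m (x : Fin (p + q) → ℝ) => x m} ∪
  (Set.range fun i : Fin (p + q) =>
    fun m (x : Fin (p + q) → ℝ) =>
      (if m = i then ∑ j, etaSgn p q j * x j * x j else 0)
        - 2 * (etaSgn p q i * x i) * x m)

/-- The Lie derivative of a symmetric contravariant 2-tensor along a vector field:
`(L_X g)^{ij} = X^k ∂_k g^{ij} − g^{kj} ∂_k X^i − g^{ik} ∂_k X^j`. -/
noncomputable def lieDer {n : ℕ} (Xv : Fin n → (Fin n → ℝ) → ℝ)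
    (g : Fin n → Fin n → (Fin n → ℝ) → ℝ) : Fin n → Fin n → (Fin n → ℝ) → ℝ :=
  fun i j x => ∑ k, (Xv k x * pd k (g i j) x
    - g k j x * pd k (Xv i) x - g i k x * pd k (Xv j) x)

/-- The action of a vector field on half-densities, in coordinates:
`ℓ_X f = Xⁱ ∂ᵢ f + (1/2)(∂ᵢ Xⁱ) f`. -/
noncomputable def halfDensAct {n : ℕ} (Xv : Fin n → (Fin n → ℝ) → ℝ)
    (f : (Fin n → ℝ) → ℝ) : (Fin n → ℝ) → ℝ :=
  fun x => (∑ i, Xv i x * pd i f x) + (1 / 2) * (∑ i, pd i (Xv i) x) * f x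

/-- The candidate quantization map with undetermined coefficients `a`, `b`, `c`:
`Q_{a,b,c}(g)f = g^{ij}∂ᵢ∂ⱼf + a(∂ⱼg^{ij})∂ᵢf + b(∂ᵢ∂ⱼg^{ij})f
 + c η^{kl}∂_k∂_l(η_{ij}g^{ij}) f`. -/
noncomputable def Qabc (p q : ℕ) (a b c : ℝ)
    (g : Fin (p + q) → Fin (p + q) → (Fin (p + q) → ℝ) → ℝ)
    (f : (Fin (p + q) → ℝ) → ℝ) : (Fin (p + q) → ℝ) → ℝ :=
  fun x => (∑ i, ∑ j, g i j x * pd i (pd j f) x)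
    + a * (∑ i, ∑ j, pd j (g i j) x * pd i f x)
    + b * (∑ i, ∑ j, pd i (pd j (g i j)) x) * f x
    + c * (∑ k, etaSgn p q k * pd k (pd k (fun y => ∑ i, etaSgn p q i * g i i y)) x) * f x

section aux

theorem pd_add' {n : ℕ} (i : Fin n) {f g : (Fin n → ℝ) → ℝ} (hf : Differentiable ℝ f)
    (hg : Differentiable ℝ g) : pd i (fun x => f x + g x) = fun x => pd i f x + pd i g x := by
  funext x; simp only [pd]; rw [fderiv_fun_add (hf x) (hg x)]; simp

theorem pd_sub' {n : ℕ} (i : Fin n) {f g : (Fin n → ℝ) → ℝ} (hf : Differentiable ℝ f)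
    (hg : Differentiable ℝ g) : pd i (fun x => f x - g x) = fun x => pd i f x - pd i g x := by
  funext x; simp only [pd]; rw [fderiv_fun_sub (hf x) (hg x)]; simp

theorem pd_mul' {n : ℕ} (i : Fin n) {f g : (Fin n → ℝ) → ℝ} (hf : Differentiable ℝ f)
    (hg : Differentiable ℝ g) :
    pd i (fun x => f x * g x) = fun x => f x * pd i g x + g x * pd i f x := by
  funext x; simp only [pd]; rw [fderiv_fun_mul (hf x) (hg x)]; simp

theorem pd_cmul {n : ℕ} (i : Fin n) (c : ℝ) {g : (Fin n → ℝ) → ℝ} 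
    (hg : Differentiable ℝ g) :
    pd i (fun x => c * g x) = fun x => c * pd i g x := by
  funext x; simp only [pd]; rw [fderiv_const_mul (hg x)]; simp

theorem pd_const' {n : ℕ} (i : Fin n) (c : ℝ) :
    pd i (fun _ => c) = fun _ => 0 := by
  funext x; simp [pd]

theorem pd_coord {n : ℕ} (i m : Fin n) :
    pd i (fun x => x m) = fun _ => if m = i then 1 else 0 := by
  funext x; simp only [pd]
  rw [(hasFDerivAt_apply m x).fderiv]; simp [Pi.single_apply]

/-- squared norm -/
def nrm (p q : ℕ) (x : Fin (p + q) → ℝ) : ℝ := ∑ j, etaSgn p q j * x j * x j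

theorem nrm_diff (p q : ℕ) : Differentiable ℝ (nrm p q) := by
  unfold nrm; fun_prop

theorem pd_nrm (p q : ℕ) (i) : pd i (nrm p q) = fun x => 2 * etaSgn p q i * x i := by
  funext x
  have h : HasFDerivAt (nrm p q) (∑ j, ((etaSgn p q j * x j) • ContinuousLinearMap.proj (R := ℝ)
      (φ := fun _ => ℝ) j + x j • (etaSgn p q j • ContinuousLinearMap.proj (R := ℝ)
      (φ := fun _ => ℝ) j))) x := by
    unfold nrm
    apply HasFDerivAt.fun_sum
    intro j _
    exact ((hasFDerivAt_apply j x).const_mul _).mul (hasFDerivAt_apply j x)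
  simp only [pd]
  rw [h.fderiv]
  simp [Pi.single_apply, Finset.sum_add_distrib]
  ring

/-- inversion -/
def Xi (p q : ℕ) (o m : Fin (p + q)) (x : Fin (p + q) → ℝ) : ℝ :=
  (if m = o then 1 else 0) * nrm p q x - (2 * etaSgn p q o) * (x o * x m)

theorem Xi_mem (p q : ℕ) (o) : Xi p q o ∈ Submodule.span ℝ (confGenSm p q) := by
  apply Submodule.subset_span
  right
  refine ⟨o, ?_⟩
  funext m x
  simp only [Xi, nrm]
  split_ifs <;> ring

theorem Xi_diff (p q : ℕ) (o m) : Differentiable ℝ (Xi p q o m) := by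
  have := nrm_diff p q
  unfold Xi; fun_prop

theorem pd_Xi (p q : ℕ) (o m k) : pd k (Xi p q o m) = fun x =>
    (if m = o then 1 else 0) * (2 * etaSgn p q k * x k)
      - (2 * etaSgn p q o) * (x o * (if m = k then 1 else 0) + x m * (if o = k then 1 else 0)) := by
  have := nrm_diff p q
  unfold Xi
  rw [pd_sub' _ (by fun_prop) (by fun_prop), pd_cmul _ _ (by fun_prop), pd_cmul _ _ (by fun_prop),
    pd_mul' _ (by fun_prop) (by fun_prop), pd_coord, pd_coord, pd_nrm]

theorem etaSq (p q : ℕ) (o) : etaSgn p q o * etaSgn p q o = 1 := by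
  unfold etaSgn; split_ifs <;> norm_num

theorem divXi (p q : ℕ) (o) (x) : ∑ k, pd k (Xi p q o k) x =
    - 2 * ((p + q : ℕ) : ℝ) * etaSgn p q o * x o := by
  simp only [pd_Xi]
  simp [Finset.sum_add_distrib, Finset.sum_sub_distrib, ← Finset.mul_sum]
  ring

theorem hda_zero (p q : ℕ) (o) (F) : halfDensAct (Xi p q o) F 0 = 0 := by
  simp [halfDensAct, divXi]
  simp [Xi, nrm]

theorem hda_one (p q : ℕ) (o) : halfDensAct (Xi p q o) (fun _ => 1) =
    fun x => (- ((p + q : ℕ) : ℝ) * etaSgn p q o) * x o := by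
  funext x
  simp only [halfDensAct, divXi, pd_const']
  simp; ring

theorem hda_coord (p q : ℕ) (o) : halfDensAct (Xi p q o) (fun x => x o) =
    fun x => nrm p q x + (- (2 + ((p + q : ℕ) : ℝ)) * etaSgn p q o) * (x o * x o) := by
  funext x
  simp only [halfDensAct, divXi, pd_coord]
  simp [Xi]; ring

/-- elementary tensor -/
def gg {n : ℕ} (u : Fin n) (φ : (Fin n → ℝ) → ℝ) (i j : Fin n) (x : Fin n → ℝ) : ℝ :=
  (if i = u then 1 else 0) * (if j = u then 1 else 0) * φ x

theorem lie_gg (p q : ℕ) (o u) (φ : (Fin (p+q) → ℝ) → ℝ) (h : Differentiable ℝ φ) (i j) :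
    lieDer (Xi p q o) (gg u φ) i j = fun x =>
      (if i = u then 1 else 0) * (if j = u then 1 else 0) * (∑ k, Xi p q o k x * pd k φ x)
      - (if j = u then 1 else 0) * (φ x * pd u (Xi p q o i) x)
      - (if i = u then 1 else 0) * (φ x * pd u (Xi p q o j) x) := by
  funext x
  unfold lieDer gg
  simp only [pd_cmul _ _ h, Finset.sum_sub_distrib, Finset.mul_sum]
  congr 1
  · congr 1
    · apply Finset.sum_congr rfl; intros; ring
    · simp
  · simp

/-- quadratic normal form -/
def qf (p q : ℕ) (o k l m r : Fin (p + q)) (A B C D : ℝ) (x : Fin (p + q) → ℝ) : ℝ :=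
  A * nrm p q x + B * (x o * x o) + C * (x k * x l) + D * (x m * x r)

theorem pd_qf (p q : ℕ) (o k l m r : Fin (p + q)) (A B C D : ℝ) (j) :
    pd j (qf p q o k l m r A B C D) = fun x => A * (2 * etaSgn p q j * x j)
      + B * (x o * (if o = j then 1 else 0) + x o * (if o = j then 1 else 0))
      + C * (x k * (if l = j then 1 else 0) + x l * (if k = j then 1 else 0))
      + D * (x m * (if r = j then 1 else 0) + x r * (if m = j then 1 else 0)) := by
  have := nrm_diff p q
  unfold qf
  rw [pd_add' _ (by fun_prop) (by fun_prop), pd_add' _ (by fun_prop) (by fun_prop),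
    pd_add' _ (by fun_prop) (by fun_prop),
    pd_cmul _ _ (by fun_prop), pd_cmul _ _ (by fun_prop),
    pd_cmul _ _ (by fun_prop), pd_cmul _ _ (by fun_prop),
    pd_mul' _ (by fun_prop) (by fun_prop), pd_mul' _ (by fun_prop) (by fun_prop),
    pd_mul' _ (by fun_prop) (by fun_prop), pd_nrm]
  simp only [pd_coord]

theorem pd_lin {n : ℕ} (i a b c d e f : Fin n) (A B C D α β γ δ ε ζ : ℝ) :
    pd i (fun x => A * (α * x a) + B * (x b * β + x b * β) + C * (x c * γ + x d * δ)
      + D * (x e * ε + x f * ζ)) = fun _ => A * (α * (if a = i then 1 else 0))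
      + B * ((if b = i then 1 else 0) * β + (if b = i then 1 else 0) * β)
      + C * ((if c = i then 1 else 0) * γ + (if d = i then 1 else 0) * δ)
      + D * ((if e = i then 1 else 0) * ε + (if f = i then 1 else 0) * ζ) := by
  funext x
  have h : ∀ m : Fin n, HasFDerivAt (fun x : Fin n → ℝ => x m) (ContinuousLinearMap.proj (R := ℝ)
      (φ := fun _ => ℝ) m) x := fun m => hasFDerivAt_apply m x
  have H := ((((((h a).const_mul α).const_mul A)).add
    ((((h b).mul_const β).add ((h b).mul_const β)).const_mul B)).add
    ((((h c).mul_const γ).add ((h d).mul_const δ)).const_mul C)).add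
    ((((h e).mul_const ε).add ((h f).mul_const ζ)).const_mul D)
  simp only [pd]
  refine (congrArg (fun L => L (Pi.single i 1)) H.fderiv).trans ?_
  simp [Pi.single_apply, mul_add]

theorem pd_pd_qf (p q : ℕ) (o k l m r : Fin (p + q)) (A B C D : ℝ) (i j) (x) :
    pd i (pd j (qf p q o k l m r A B C D)) x = A * (2 * etaSgn p q j * (if j = i then 1 else 0))
      + B * ((if o = i then 1 else 0) * (if o = j then 1 else 0)
        + (if o = i then 1 else 0) * (if o = j then 1 else 0))
      + C * ((if k = i then 1 else 0) * (if l = j then 1 else 0)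
        + (if l = i then 1 else 0) * (if k = j then 1 else 0))
      + D * ((if m = i then 1 else 0) * (if r = j then 1 else 0)
        + (if r = i then 1 else 0) * (if m = j then 1 else 0)) := by
  rw [pd_qf, pd_lin]

theorem lie1 (p q : ℕ) (o u) (hou : u ≠ o) (i j) :
    lieDer (Xi p q o) (gg u (fun _ => 1)) i j = fun x =>
      (4 * etaSgn p q o * (if i = u then 1 else 0) * (if j = u then 1 else 0)) * x o
      + (- 2 * etaSgn p q u * ((if j = u then 1 else 0) * (if i = o then 1 else 0)
        + (if i = u then 1 else 0) * (if j = o then 1 else 0))) * x u := by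
  rw [lie_gg _ _ _ _ _ (by fun_prop)]
  funext x
  simp only [pd_const', pd_Xi, if_neg hou.symm]
  simp only [mul_zero, Finset.sum_const_zero]
  ring

theorem lie2 (p q : ℕ) (o u) (hou : u ≠ o) (i j) :
    lieDer (Xi p q o) (gg u (fun x => x o)) i j = qf p q o o u o o
      ((if i = u then 1 else 0) * (if j = u then 1 else 0))
      (2 * etaSgn p q o * (if i = u then 1 else 0) * (if j = u then 1 else 0))
      (- 2 * etaSgn p q u * ((if j = u then 1 else 0) * (if i = o then 1 else 0)
        + (if i = u then 1 else 0) * (if j = o then 1 else 0))) 0 := by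
  rw [lie_gg _ _ _ _ _ (by fun_prop)]
  funext x
  simp only [pd_coord, pd_Xi, if_neg hou.symm, qf]
  simp only [mul_ite, mul_one, mul_zero, Finset.sum_ite_eq, Finset.mem_univ, if_true, Xi]
  split_ifs <;> ring

theorem lie3 (p q : ℕ) (o) (i j) :
    lieDer (Xi p q o) (gg o (fun x => x o)) i j = qf p q o o i o j
      ((if i = o then 1 else 0) * (if j = o then 1 else 0))
      (-2 * etaSgn p q o * (if i = o then 1 else 0) * (if j = o then 1 else 0))
      (2 * etaSgn p q o * (if j = o then 1 else 0))
      (2 * etaSgn p q o * (if i = o then 1 else 0)) := by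
  rw [lie_gg _ _ _ _ _ (by fun_prop)]
  funext x
  simp only [pd_coord, pd_Xi, qf]
  simp only [mul_ite, mul_one, mul_zero, Finset.sum_ite_eq, Finset.mem_univ, if_true, Xi]
  split_ifs <;> subst_vars <;> ring

theorem tr2 (p q : ℕ) (o u) (hou : u ≠ o) :
    (fun y => ∑ i, etaSgn p q i * lieDer (Xi p q o) (gg u (fun x => x o)) i i y) =
      qf p q o o o o o (etaSgn p q u) (2 * etaSgn p q o * etaSgn p q u) 0 0 := by
  funext y
  have : ∀ i, etaSgn p q i * lieDer (Xi p q o) (gg u (fun x => x o)) i i y =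
      if i = u then etaSgn p q u * (nrm p q y + 2 * etaSgn p q o * (y o * y o)) else 0 := by
    intro i
    rw [lie2 _ _ _ _ hou]
    simp only [qf]
    by_cases h : i = u
    · subst h; simp [hou]
    · simp [h]
  simp only [this, Finset.sum_ite_eq', Finset.mem_univ, if_true, qf]
  ring

theorem tr3 (p q : ℕ) (o) :
    (fun y => ∑ i, etaSgn p q i * lieDer (Xi p q o) (gg o (fun x => x o)) i i y) =
      qf p q o o o o o (etaSgn p q o) (2 * etaSgn p q o * etaSgn p q o) 0 0 := by
  funext y
  have : ∀ i, etaSgn p q i * lieDer (Xi p q o) (gg o (fun x => x o)) i i y =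
      if i = o then etaSgn p q o * (nrm p q y + 2 * etaSgn p q o * (y o * y o)) else 0 := by
    intro i
    rw [lie3]
    simp only [qf]
    by_cases h : i = o
    · subst h; simp; try ring
    · simp [h]
  simp only [this, Finset.sum_ite_eq', Finset.mem_univ, if_true, qf]
  ring

theorem box_tr (p q : ℕ) (o u : Fin (p + q)) :
    ∑ k, etaSgn p q k * pd k (pd k (qf p q o o o o o (etaSgn p q u)
      (2 * etaSgn p q o * etaSgn p q u) 0 0)) 0
      = etaSgn p q u * (2 * ((p + q : ℕ) : ℝ) + 4) := by
  have : ∀ k, etaSgn p q k * pd k (pd k (qf p q o o o o o (etaSgn p q u)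
      (2 * etaSgn p q o * etaSgn p q u) 0 0)) 0 =
      etaSgn p q u * 2 + if o = k then 4 * etaSgn p q u else 0 := by
    intro k
    rw [pd_pd_qf]
    have := etaSq p q k
    by_cases h : o = k
    · subst h; simp; linear_combination (6 * etaSgn p q u) * this
    · simp [h]; linear_combination (2 * etaSgn p q u) * this
  rw [Finset.sum_congr rfl (fun k _ => this k), Finset.sum_add_distrib]
  simp
  ring

theorem dd2 (p q : ℕ) (o u : Fin (p + q)) (hou : u ≠ o) :
    ∑ i, ∑ j, pd i (pd j (lieDer (Xi p q o) (gg u (fun x => x o)) i j)) 0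
      = - 2 * etaSgn p q u := by
  simp only [lie2 _ _ _ _ hou, pd_pd_qf]
  simp [mul_add, add_mul, Finset.sum_add_distrib, hou, hou.symm]

theorem dd3 (p q : ℕ) (o : Fin (p + q)) :
    ∑ i, ∑ j, pd i (pd j (lieDer (Xi p q o) (gg o (fun x => x o)) i j)) 0
      = etaSgn p q o * (4 * ((p + q : ℕ) : ℝ) + 2) := by
  simp only [lie3, pd_pd_qf]
  simp [mul_add, add_mul, Finset.sum_add_distrib]
  ring

theorem gg_smooth {n : ℕ} (u : Fin n) (φ) (h : ContDiff ℝ (⊤ : ℕ∞) φ) (i j) :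
    ContDiff ℝ (⊤ : ℕ∞) (gg u φ i j) := by
  unfold gg; fun_prop

theorem gg_symm {n : ℕ} (u : Fin n) (φ) (i j) : gg u φ i j = gg u φ j i := by
  funext x; unfold gg; ring

theorem pd_gg {n : ℕ} (u : Fin n) (φ) (h : Differentiable ℝ φ) (i j k) :
    pd k (gg u φ i j) = fun x => (if i = u then 1 else 0) * (if j = u then 1 else 0) * pd k φ x := by
  unfold gg; rw [pd_cmul _ _ h]

theorem hda_coord' (p q : ℕ) (o) : halfDensAct (Xi p q o) (fun x => x o) =
    qf p q o o o o o 1 (- (2 + ((p + q : ℕ) : ℝ)) * etaSgn p q o) 0 0 := by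
  rw [hda_coord]; funext x; simp [qf]

theorem d1 (p q : ℕ) (o u : Fin (p + q)) (hou : u ≠ o) :
    ∑ i, ∑ j, pd j (lieDer (Xi p q o) (gg u (fun _ => 1)) i j) 0 * pd i (fun x => x o) 0
      = - 2 * etaSgn p q u := by
  have : ∀ i j, pd j (lieDer (Xi p q o) (gg u (fun _ => 1)) i j) 0 =
      (4 * etaSgn p q o * (if i = u then 1 else 0) * (if j = u then 1 else 0))
        * (if o = j then 1 else 0)
      + (- 2 * etaSgn p q u * ((if j = u then 1 else 0) * (if i = o then 1 else 0)
        + (if i = u then 1 else 0) * (if j = o then 1 else 0))) * (if u = j then 1 else 0) := by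
    intro i j
    rw [lie1 _ _ _ _ hou, pd_add' _ (by fun_prop) (by fun_prop), pd_cmul _ _ (by fun_prop),
      pd_cmul _ _ (by fun_prop), pd_coord, pd_coord]
  simp only [this, pd_coord]
  simp [mul_add, Finset.sum_add_distrib, hou, hou.symm]

end aux

/-- Uniqueness of the conformally equivariant quantization at weights `λ = μ = 1/2`
in the second-order case: if `Q_{a,b,c}` is equivariant under the conformal algebra for
all smooth symmetric 2-tensors, then `a = 1`, `b = n/(4(n+1))`, `c = n/(4(n+1)(n+2))`. -/
theorem stmt9 (p q : ℕ) (hn : 2 ≤ p + q) (a b c : ℝ)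
    (heq : ∀ g : Fin (p + q) → Fin (p + q) → (Fin (p + q) → ℝ) → ℝ,
      (∀ i j, ContDiff ℝ (⊤ : ℕ∞) (g i j)) → (∀ i j, g i j = g j i) →
      ∀ Xv ∈ Submodule.span ℝ (confGenSm p q),
      ∀ f : (Fin (p + q) → ℝ) → ℝ, ContDiff ℝ (⊤ : ℕ∞) f → ∀ x,
        Qabc p q a b c (lieDer Xv g) f x
          = halfDensAct Xv (Qabc p q a b c g f) x
            - Qabc p q a b c g (halfDensAct Xv f) x) :
    a = 1 ∧ b = ((p + q : ℕ) : ℝ) / (4 * ((p + q : ℕ) + 1))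
      ∧ c = ((p + q : ℕ) : ℝ) / (4 * ((p + q : ℕ) + 1) * ((p + q : ℕ) + 2)) := by
  have hN : (0 : ℝ) < ((p + q : ℕ) : ℝ) := by exact_mod_cast (by omega : 0 < p + q)
  set o : Fin (p + q) := ⟨0, by omega⟩ with ho
  set u : Fin (p + q) := ⟨1, by omega⟩ with hu
  have hou : u ≠ o := by simp [ho, hu]
  clear_value o u
  have eo : etaSgn p q o ≠ 0 := by
    intro h; have := etaSq p q o; rw [h] at this; norm_num at this
  have eu : etaSgn p q u ≠ 0 := by
    intro h; have := etaSq p q u; rw [h] at this; norm_num at this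
  have h1 := heq (gg u (fun _ => 1)) (gg_smooth _ _ (by fun_prop)) (gg_symm _ _) _ (Xi_mem p q o)
    (fun x => x o) (by fun_prop) 0
  have h2 := heq (gg u (fun x => x o)) (gg_smooth _ _ (by fun_prop)) (gg_symm _ _) _ (Xi_mem p q o)
    (fun _ => 1) (by fun_prop) 0
  have h3 := heq (gg o (fun x => x o)) (gg_smooth _ _ (by fun_prop)) (gg_symm _ _) _ (Xi_mem p q o)
    (fun _ => 1) (by fun_prop) 0
  clear heq
  have dc : ∀ m : Fin (p + q), Differentiable ℝ (fun x : Fin (p + q) → ℝ => x m) :=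
    fun m => by fun_prop
  rw [hda_zero, hda_coord'] at h1
  rw [hda_zero, hda_one] at h2 h3
  unfold Qabc at h1 h2 h3
  rw [dd2 _ _ _ _ hou, tr2 _ _ _ _ hou, box_tr] at h2
  rw [d1 _ _ _ _ hou] at h1
  rw [dd3, tr3, box_tr] at h3
  have ha : a = 1 := by
    simp only [pd_const', pd_coord, pd_gg u _ (differentiable_const (1 : ℝ)), pd_pd_qf, lie1 _ _ _ _ hou] at h1
    simp [hou.symm, gg, qf, nrm] at h1
    apply mul_right_cancel₀ eu
    linarith
  have hb : b * (-2) + c * (2 * ((p + q : ℕ) : ℝ) + 4) = 0 := by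
    simp only [pd_const', pd_coord, pd_cmul _ _ (dc o), pd_gg _ _ (dc o)] at h2
    simp [hou.symm] at h2
    push_cast
    apply mul_right_cancel₀ eu
    linarith
  have hc : b * (4 * ((p + q : ℕ) : ℝ) + 2) + c * (2 * ((p + q : ℕ) : ℝ) + 4)
      = ((p + q : ℕ) : ℝ) := by
    simp only [pd_const', pd_coord, pd_cmul _ _ (dc o), pd_gg _ _ (dc o)] at h3
    simp at h3
    rw [ha] at h3
    push_cast
    apply mul_right_cancel₀ eo
    linarith
  generalize ((p + q : ℕ) : ℝ) = N at *
  have hb' : b = N / (4 * (N + 1)) := by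
    rw [eq_div_iff (by positivity)]; linarith
  refine ⟨ha, hb', ?_⟩
  rw [eq_div_iff (by positivity)]
  have : b = c * (N + 2) := by linarith
  have h5 : b * (4 * (N + 1)) = N := by linarith
  rw [this] at h5
  linarith
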